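/- Let q ≥ 9 be a prime power with q ≡ 1 (mod 4), and let G = PSL₂(q). If χ and χ′ are two distinct irreducible complex characters of G, both of degree (q + 1)/2, then ⟨χ², χ′⟩ = 0; in particular c(χ²) ≠ Irr(G), so the character covering number of G is not 2. -/

import Mathlib

open scoped BigOperators

/-- The standard inner product of complex-valued class functions on a finite group:
`⟨α, β⟩ = |G|⁻¹ ∑ g, α g * conj (β g)`. -/
noncomputable def charInner {G : Type} [Group G] [Finite G] (α β : G → ℂ) : ℂ :=
  letI : Fintype G := Fintype.ofFinite G
  (Fintype.card G : ℂ)⁻¹ * ∑ g : G, α g * (starRingEnd ℂ) (β g)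

/-- `χ : G → ℂ` is an irreducible character if it is the character of some
irreducible (simple) finite-dimensional complex representation of `G`. -/
def IsIrreducibleCharacter (G : Type) [Group G] (χ : G → ℂ) : Prop :=
  ∃ V : FDRep ℂ G, CategoryTheory.Simple V ∧ χ = V.character

open scoped MatrixGroups

section Borel

variable {F : Type*} [Field F]

/-- The upper triangular matrix of determinant one with diagonal `a, a⁻¹` and corner `x`. -/
def upperSL (a : Fˣ) (x : F) : SL(2, F) :=
  ⟨!![(a : F), x; 0, ((a⁻¹ : Fˣ) : F)], by simp [Matrix.det_fin_two_of]⟩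

@[simp]
lemma coe_upperSL (a : Fˣ) (x : F) :
    (upperSL a x : Matrix (Fin 2) (Fin 2) F) = !![(a : F), x; 0, ((a⁻¹ : Fˣ) : F)] := rfl

lemma upperSL_mul (a b : Fˣ) (x y : F) :
    upperSL a x * upperSL b y = upperSL (a * b) (a * y + x * ((b⁻¹ : Fˣ) : F)) := by
  ext i j
  fin_cases i <;> fin_cases j <;> simp [Matrix.mul_apply, Fin.sum_univ_two, mul_comm]

lemma upperSL_one_zero : upperSL (1 : Fˣ) (0 : F) = 1 := by
  ext i j
  fin_cases i <;> fin_cases j <;> simp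

lemma upperSL_inv (a : Fˣ) (x : F) : (upperSL a x)⁻¹ = upperSL a⁻¹ (-x) := by
  rw [inv_eq_iff_mul_eq_one, upperSL_mul, ← upperSL_one_zero]
  congr 1
  · simp
  · simp [mul_comm]

lemma upperSL_neg (a : Fˣ) (x : F) : upperSL (-a) x = -upperSL a (-x) := by
  ext i j
  fin_cases i <;> fin_cases j <;> simp

lemma upperSL_conj_unipotent (a : Fˣ) (x : F) :
    upperSL a 0 * upperSL 1 x * (upperSL a 0)⁻¹ = upperSL 1 ((a : F) ^ 2 * x) := by
  rw [upperSL_inv, upperSL_mul, upperSL_mul]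
  congr 1
  · simp
  · simp; ring

lemma exists_conj_upperSL (a : Fˣ) (ha : a ^ 2 ≠ 1) (x : F) :
    ∃ h, h * upperSL a 0 * h⁻¹ = upperSL a x := by
  have h0 : ((a⁻¹ : Fˣ) : F) - a ≠ 0 := by
    intro h
    apply ha
    rw [sub_eq_zero] at h
    rw [pow_two]
    nth_rewrite 1 [← Units.ext h]
    simp
  refine ⟨upperSL 1 (x / (((a⁻¹ : Fˣ) : F) - a)), ?_⟩
  rw [upperSL_inv, upperSL_mul, upperSL_mul]
  congr 1
  · simp
  · have : x = x / (((a⁻¹ : Fˣ) : F) - a) * (((a⁻¹ : Fˣ) : F) - a) := by field_simp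
    nth_rewrite 3 [this]
    simp; ring

/-- The standard Weyl element of `SL₂`. -/
def weylSL : SL(2, F) := ⟨!![0, 1; -1, 0], by simp [Matrix.det_fin_two_of]⟩

@[simp]
lemma coe_weylSL : ((weylSL : SL(2, F)) : Matrix (Fin 2) (Fin 2) F) = !![0, 1; -1, 0] := rfl

lemma weylSL_conj (a : Fˣ) : weylSL * upperSL a 0 * weylSL⁻¹ = upperSL a⁻¹ 0 := by
  rw [mul_inv_eq_iff_eq_mul]
  ext i j
  fin_cases i <;> fin_cases j <;>
    simp [Matrix.mul_apply, Fin.sum_univ_two]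

lemma exists_eq_upperSL (g : SL(2, F)) (hg : g.1 1 0 = 0) : ∃ a x, g = upperSL a x := by
  have hd := g.2
  rw [Matrix.det_fin_two, hg, mul_zero, sub_zero] at hd
  refine ⟨⟨g.1 0 0, g.1 1 1, hd, by rw [mul_comm]; exact hd⟩, g.1 0 1, ?_⟩
  ext i j
  fin_cases i <;> fin_cases j <;> simp [hg]

lemma upperSL_conj_entry (h : SL(2, F)) (a : Fˣ) (x : F) :
    (h⁻¹ * upperSL a x * h).1 1 0 =
      h.1 1 0 * ((((a⁻¹ : Fˣ) : F) - a) * h.1 0 0 - x * h.1 1 0) := by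
  simp [Matrix.adjugate_fin_two, Matrix.mul_apply, Fin.sum_univ_two]
  ring

variable [Fintype F] [DecidableEq F]

/-- The number of elements conjugating `g` into the upper triangular subgroup. -/
def borelCount (g : SL(2, F)) : ℕ := Fintype.card {h : SL(2, F) // (h⁻¹ * g * h).1 1 0 = 0}

lemma borelCount_conj (k g : SL(2, F)) : borelCount (k * g * k⁻¹) = borelCount g := by
  refine Fintype.card_congr ((Equiv.mulLeft k⁻¹).subtypeEquiv fun h => ?_)
  simp [mul_assoc]

lemma borelCount_neg (g : SL(2, F)) : borelCount (-g) = borelCount g := by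
  refine Fintype.card_congr ((Equiv.refl _).subtypeEquiv fun h => ?_)
  simp

lemma borelCount_ne_zero_iff (g : SL(2, F)) :
    borelCount g ≠ 0 ↔ ∃ h a x, g = h * upperSL a x * h⁻¹ := by
  rw [borelCount, ← Nat.pos_iff_ne_zero, Fintype.card_pos_iff]
  constructor
  · rintro ⟨h, hh⟩
    obtain ⟨a, x, hx⟩ := exists_eq_upperSL _ hh
    exact ⟨h, a, x, by rw [← hx]; group⟩
  · rintro ⟨h, a, x, rfl⟩
    refine ⟨h, ?_⟩
    rw [show h⁻¹ * (h * upperSL a x * h⁻¹) * h = upperSL a x by group]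
    simp

lemma borelCount_one : borelCount (1 : SL(2, F)) = Fintype.card SL(2, F) := by
  rw [borelCount, Fintype.card_subtype, ← Finset.card_univ]
  congr 1
  ext h
  simp

/-- The upper triangular subgroup is parametrized by diagonal entry and corner. -/
noncomputable def borelEquiv : Fˣ × F ≃ {h : SL(2, F) // h.1 1 0 = 0} :=
  Equiv.ofBijective (fun p => ⟨upperSL p.1 p.2, by simp [upperSL]⟩) (by
    constructor
    · rintro ⟨a, x⟩ ⟨b, y⟩ h
      have h1 := congrArg (fun g => g.1.1 0 0) h
      have h2 := congrArg (fun g => g.1.1 0 1) h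
      simp only [coe_upperSL, Matrix.of_apply, Matrix.cons_val', Matrix.cons_val_zero,
        Matrix.cons_val_one] at h1 h2
      rw [Units.ext h1, h2]
    · rintro ⟨g, hg⟩
      obtain ⟨a, x, rfl⟩ := exists_eq_upperSL g hg
      exact ⟨(a, x), rfl⟩)

lemma card_borel : Fintype.card {h : SL(2, F) // h.1 1 0 = 0} =
    (Fintype.card F - 1) * Fintype.card F := by
  rw [← Fintype.card_congr borelEquiv, Fintype.card_prod, Fintype.card_units]

lemma borelCount_unipotent (x : F) (hx : x ≠ 0) :
    borelCount (upperSL 1 x) = (Fintype.card F - 1) * Fintype.card F := by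
  rw [← card_borel]
  refine Fintype.card_congr ((Equiv.refl _).subtypeEquiv fun h => ?_)
  simp [upperSL_conj_entry, hx]

lemma borelCount_torus (a : Fˣ) (ha : a ^ 2 ≠ 1) :
    borelCount (upperSL a 0) = 2 * ((Fintype.card F - 1) * Fintype.card F) := by
  have h0 : ((a⁻¹ : Fˣ) : F) - a ≠ 0 := by
    intro h
    apply ha
    rw [sub_eq_zero] at h
    rw [pow_two]
    nth_rewrite 1 [← Units.ext h]
    simp
  have h1 : Fintype.card {h : SL(2, F) // h.1 0 0 = 0} =
      Fintype.card {h : SL(2, F) // h.1 1 0 = 0} := by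
    refine Fintype.card_congr ((Equiv.mulLeft weylSL).subtypeEquiv fun h => ?_)
    simp [Matrix.mul_apply, Fin.sum_univ_two]
  have h2 : borelCount (upperSL a 0) =
      Fintype.card {h : SL(2, F) // h.1 1 0 = 0 ∨ h.1 0 0 = 0} := by
    refine Fintype.card_congr ((Equiv.refl _).subtypeEquiv fun h => ?_)
    rw [Equiv.refl_apply, upperSL_conj_entry, zero_mul, sub_zero, mul_eq_zero, mul_eq_zero,
      or_iff_right h0]
  rw [h2, Fintype.card_subtype_or_disjoint, h1, card_borel, two_mul]
  rw [Pi.disjoint_iff]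
  intro h
  rw [Prop.disjoint_iff]
  by_contra! hh
  have := h.2
  rw [Matrix.det_fin_two, hh.1, hh.2] at this
  simp at this

/-- An open Bruhat cell is parametrized by its first column and one further entry. -/
def bigCellEquiv : {h : SL(2, F) // h.1 1 0 ≠ 0} ≃ Fˣ × F × F where
  toFun h := (Units.mk0 _ h.2, h.1.1 0 0, h.1.1 1 1)
  invFun p := ⟨⟨!![p.2.1, (p.2.1 * p.2.2 - 1) * ((p.1⁻¹ : Fˣ) : F); (p.1 : F), p.2.2],
    by simp [Matrix.det_fin_two_of]⟩, by simp⟩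
  left_inv h := by
    have := h.1.2
    rw [Matrix.det_fin_two] at this
    have h0 := h.2
    ext i j
    fin_cases i <;> fin_cases j <;> simp
    field_simp
    linear_combination this
  right_inv p := by
    ext <;> simp

lemma card_SL_two : Fintype.card SL(2, F) =
    (Fintype.card F + 1) * ((Fintype.card F - 1) * Fintype.card F) := by
  have := Fintype.card_subtype_compl (fun h : SL(2, F) => h.1 1 0 = 0)
  have h1 := Fintype.card_congr (bigCellEquiv (F := F))
  have h2 := Fintype.card_subtype_le (fun h : SL(2, F) => h.1 1 0 = 0)
  rw [Fintype.card_prod, Fintype.card_prod, Fintype.card_units] at h1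
  rw [card_borel] at this h2
  simp only [ne_eq] at h1
  rw [h1] at this
  have h3 : Fintype.card SL(2, F) = (Fintype.card F - 1) * (Fintype.card F * Fintype.card F) +
    (Fintype.card F - 1) * Fintype.card F := by omega
  rw [h3]; ring

omit [Fintype F] [DecidableEq F] in
lemma one_ne_neg_one_units (h2 : (2 : F) ≠ 0) : (1 : Fˣ) ≠ -1 := by
  intro h
  apply h2
  have := congrArg Units.val h
  simp at this
  linear_combination this

lemma filter_sq_eq_one :
    (Finset.univ.filter fun a : Fˣ => ¬ a ^ 2 ≠ 1) = {1, -1} := by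
  ext a
  simp only [ne_eq, not_not, Finset.mem_filter, Finset.mem_univ, true_and, Finset.mem_insert,
    Finset.mem_singleton, Units.ext_iff]
  push_cast
  exact sq_eq_one_iff

lemma sum_borelCount_ne_zero {K : Type*} [Field K] [CharZero K] (f : SL(2, F) → K)
    (hf : ∀ h g, f (h * g * h⁻¹) = f g) :
    ∑ g, (if borelCount g = 0 then 0 else f g) =
      Fintype.card SL(2, F) * ∑ a : Fˣ, ∑ x : F,
        f (upperSL a x) / borelCount (upperSL a x) := by
  have key (g : SL(2, F)) : (if borelCount g = 0 then 0 else f g) =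
      ∑ h : SL(2, F), if (h⁻¹ * g * h).1 1 0 = 0 then f g / borelCount g else 0 := by
    rw [← Finset.sum_filter, Finset.sum_const, nsmul_eq_mul, ← Fintype.card_subtype]
    change _ = (borelCount g : K) * _
    split_ifs with h
    · simp [h]
    · field_simp
  simp_rw [key]
  rw [Finset.sum_comm]
  have key2 (h : SL(2, F)) :
      (∑ g : SL(2, F), if (h⁻¹ * g * h).1 1 0 = 0 then f g / borelCount g else 0) =
        ∑ a : Fˣ, ∑ x : F, f (upperSL a x) / borelCount (upperSL a x) := by
    rw [← Equiv.sum_comp (MulAut.conj h).toEquiv]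
    simp only [MulEquiv.toEquiv_eq_coe, MulEquiv.coe_toEquiv, MulAut.conj_apply, hf,
      borelCount_conj]
    simp only [mul_assoc, inv_mul_cancel_left, inv_mul_cancel, mul_one]
    rw [← Finset.sum_filter, Finset.sum_subtype (p := fun h : SL(2, F) => h.1 1 0 = 0) _
      (by simp), ← Equiv.sum_comp borelEquiv, Fintype.sum_prod_type]
    rfl
  simp_rw [key2]
  simp

/-- Integration over the elements of `SL₂` with an eigenvector, in terms of conjugacy classes. -/
lemma sum_split_classFunction {K : Type*} [Field K] [CharZero K] (h2 : (2 : F) ≠ 0)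
    (f : SL(2, F) → K) (hf : ∀ h g, f (h * g * h⁻¹) = f g) (hneg : ∀ g, f (-g) = f g) :
    ∑ g, (if borelCount g = 0 then 0 else f g) =
      2 * f 1 + 2 * (Fintype.card F + 1) * ∑ x : F with x ≠ 0, f (upperSL 1 x) +
      Fintype.card F * (Fintype.card F + 1) / 2 * ∑ a : Fˣ with a ^ 2 ≠ 1, f (upperSL a 0) := by
  rw [sum_borelCount_ne_zero f hf]
  have hq : 1 < Fintype.card F := Fintype.one_lt_card
  have hq' : ((Fintype.card F - 1 : ℕ) : K) = (Fintype.card F : K) - 1 := by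
    push_cast [hq.le]; ring
  have hq0 : (Fintype.card F : K) ≠ 0 := by simp
  have hq1 : (Fintype.card F : K) - 1 ≠ 0 := by
    rw [← hq', Nat.cast_ne_zero]; omega
  have hq2 : (Fintype.card F : K) + 1 ≠ 0 := by
    exact_mod_cast Nat.succ_ne_zero (Fintype.card F)
  have hsemi (a : Fˣ) (ha : a ^ 2 ≠ 1) :
      ∑ x : F, f (upperSL a x) / borelCount (upperSL a x) =
      f (upperSL a 0) / (2 * (Fintype.card F - 1)) := by
    have (x : F) : f (upperSL a x) / borelCount (upperSL a x) =
        f (upperSL a 0) / (2 * ((Fintype.card F - 1) * Fintype.card F)) := by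
      obtain ⟨h, hh⟩ := exists_conj_upperSL a ha x
      rw [← hh, hf, borelCount_conj, borelCount_torus a ha]
      push_cast [hq']
      rfl
    simp_rw [this]
    simp
    field_simp
  have huni : ∑ x : F, f (upperSL 1 x) / borelCount (upperSL 1 x) =
      f 1 / Fintype.card SL(2, F) + (∑ x : F with x ≠ 0, f (upperSL 1 x)) /
        ((Fintype.card F - 1) * Fintype.card F) := by
    rw [← Finset.add_sum_erase _ _ (Finset.mem_univ 0), upperSL_one_zero, borelCount_one,
      Finset.sum_div, Finset.filter_ne']
    congr 1
    refine Finset.sum_congr rfl fun x hx => ?_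
    rw [borelCount_unipotent x (Finset.ne_of_mem_erase hx)]
    push_cast [hq']
    rfl
  have huni' : ∑ x : F, f (upperSL (-1) x) / borelCount (upperSL (-1) x) =
      ∑ x : F, f (upperSL 1 x) / borelCount (upperSL 1 x) := by
    simp_rw [upperSL_neg, hneg, borelCount_neg]
    exact Equiv.sum_comp (Equiv.neg F) fun x => f (upperSL 1 x) / borelCount (upperSL 1 x)
  rw [← Finset.sum_filter_add_sum_filter_not _ (fun a : Fˣ => a ^ 2 ≠ 1), filter_sq_eq_one,
    Finset.sum_pair (one_ne_neg_one_units h2), huni', huni,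
    Finset.sum_congr rfl fun a ha => hsemi a (Finset.mem_filter.mp ha).2, ← Finset.sum_div,
    card_SL_two]
  push_cast [hq']
  field_simp
  ring

end Borel

section Fourier

open Multiplicative

variable {R : Type*} [CommRing R] [Fintype R]
  {V : Type*} [AddCommGroup V] [Module ℂ V]

/-- The projection onto the `ψ (c * ·)`-isotypic component of a representation of `R`. -/
noncomputable def isotypicProj (ψ : AddChar R ℂ) (τ : Multiplicative R →* Module.End ℂ V) (c : R) :
    Module.End ℂ V :=
  (Fintype.card R : ℂ)⁻¹ • ∑ b : R, ψ (-(c * b)) • τ (ofAdd b)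

lemma map_mul_isotypicProj (ψ : AddChar R ℂ) (τ : Multiplicative R →* Module.End ℂ V) (c b : R) :
    τ (ofAdd b) * isotypicProj ψ τ c = ψ (c * b) • isotypicProj ψ τ c := by
  rw [isotypicProj, mul_smul_comm, smul_comm, Finset.mul_sum]
  congr 1
  rw [← Equiv.sum_comp (Equiv.addLeft b) (fun d => ψ (-(c * d)) • τ (ofAdd d)), Finset.smul_sum]
  refine Finset.sum_congr rfl fun d _ => ?_
  rw [mul_smul_comm, ← map_mul, smul_smul, ← AddChar.map_add_eq_mul, ← ofAdd_add,
    Equiv.coe_addLeft]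
  congr 2
  ring

lemma isIdempotentElem_isotypicProj (ψ : AddChar R ℂ) (τ : Multiplicative R →* Module.End ℂ V)
    (c : R) : IsIdempotentElem (isotypicProj ψ τ c) := by
  have h0 : (Fintype.card R : ℂ) ≠ 0 := by simp
  rw [IsIdempotentElem]
  nth_rewrite 1 [isotypicProj]
  rw [smul_mul_assoc, Finset.sum_mul]
  simp_rw [smul_mul_assoc, map_mul_isotypicProj, smul_smul, ← AddChar.map_add_eq_mul]
  simp [← Nat.cast_smul_eq_nsmul ℂ, smul_smul, h0]

lemma trace_isotypicProj (ψ : AddChar R ℂ) (τ : Multiplicative R →* Module.End ℂ V) (c : R) :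
    LinearMap.trace ℂ V (isotypicProj ψ τ c) =
      (Fintype.card R : ℂ)⁻¹ * ∑ b : R, ψ (-(c * b)) * LinearMap.trace ℂ V (τ (ofAdd b)) := by
  simp [isotypicProj]

variable [FiniteDimensional ℂ V]

lemma exists_nat_trace_eq {e : Module.End ℂ V} (he : IsIdempotentElem e) :
    ∃ n : ℕ, LinearMap.trace ℂ V e = n :=
  ⟨_, (LinearMap.IsIdempotentElem.isProj_range e he).trace⟩

/-- Decomposition of a character of `R` with multiplicities. -/
lemma exists_multiplicities {ψ : AddChar R ℂ} (hψ : ψ.IsPrimitive)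
    (τ : Multiplicative R →* Module.End ℂ V) :
    ∃ m : R → ℕ, (∀ c, LinearMap.trace ℂ V (isotypicProj ψ τ c) = m c) ∧
      ∀ b, LinearMap.trace ℂ V (τ (ofAdd b)) = ∑ c, m c * ψ (c * b) := by
  classical
  choose m hm using fun c => exists_nat_trace_eq (isIdempotentElem_isotypicProj ψ τ c)
  refine ⟨m, hm, fun b => ?_⟩
  have h0 : (Fintype.card R : ℂ) ≠ 0 := by simp
  simp_rw [← hm, trace_isotypicProj, mul_assoc, Finset.sum_mul, ← Finset.mul_sum]
  rw [Finset.sum_comm]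
  have (d : R) : ∑ c, ψ (-(c * d)) * LinearMap.trace ℂ V (τ (ofAdd d)) * ψ (c * b) =
      if b = d then Fintype.card R * LinearMap.trace ℂ V (τ (ofAdd d)) else 0 := by
    have h1 := AddChar.sum_mulShift (b - d) hψ
    rw [sub_eq_zero] at h1
    have : ∀ c, ψ (-(c * d)) * LinearMap.trace ℂ V (τ (ofAdd d)) * ψ (c * b) =
        ψ (c * (b - d)) * LinearMap.trace ℂ V (τ (ofAdd d)) := fun c => by
      rw [mul_right_comm, ← AddChar.map_add_eq_mul]
      congr 2
      ring
    simp_rw [this, ← Finset.sum_mul, h1]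
    split_ifs <;> simp
  simp_rw [this]
  simp [h0]

lemma trace_neg_eq_conj {ψ : AddChar R ℂ} (hψ : ψ.IsPrimitive)
    (τ : Multiplicative R →* Module.End ℂ V) (b : R) :
    LinearMap.trace ℂ V (τ (ofAdd (-b))) =
      (starRingEnd ℂ) (LinearMap.trace ℂ V (τ (ofAdd b))) := by
  obtain ⟨m, -, hm⟩ := exists_multiplicities hψ τ
  rw [hm, hm, map_sum]
  refine Finset.sum_congr rfl fun c _ => ?_
  rw [mul_neg, AddChar.map_neg_eq_conj, map_mul (starRingEnd ℂ), Complex.conj_natCast]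

lemma trace_inv_eq_conj {G : Type*} [Group G] [Finite G] (ρ : G →* Module.End ℂ V) (g : G) :
    LinearMap.trace ℂ V (ρ g⁻¹) = (starRingEnd ℂ) (LinearMap.trace ℂ V (ρ g)) := by
  have : NeZero (orderOf g) := ⟨(orderOf_pos g).ne'⟩
  let z : ZMod (orderOf g) →+ Additive G :=
    ZMod.lift (orderOf g) ⟨zmultiplesHom (Additive G) (Additive.ofMul g), by
      simp [← ofMul_pow, pow_orderOf_eq_one]⟩
  have hz : z 1 = Additive.ofMul g := by
    have := ZMod.lift_coe (orderOf g) ⟨zmultiplesHom (Additive G) (Additive.ofMul g), by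
      simp [← ofMul_pow, pow_orderOf_eq_one]⟩ 1
    simpa using this
  have h := trace_neg_eq_conj (ZMod.isPrimitive_stdAddChar (orderOf g))
    (ρ.comp (AddMonoidHom.toMultiplicativeLeft z)) 1
  simpa [hz] using h

/-- On a rank one projection commuting with `A` and `B`, the trace is multiplicative. -/
lemma trace_mul_trace_of_trace_eq_one {P A B : Module.End ℂ V} (hP : IsIdempotentElem P)
    (hP1 : LinearMap.trace ℂ V P = 1) (hB : Commute B P) :
    LinearMap.trace ℂ V (A * P) * LinearMap.trace ℂ V (B * P) =
      LinearMap.trace ℂ V (A * B * P) := by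
  have hr := (LinearMap.IsIdempotentElem.isProj_range P hP).trace
  rw [hP1] at hr
  have hr' : Module.finrank ℂ (LinearMap.range P) = 1 := by exact_mod_cast hr.symm
  obtain ⟨v, hv0, hv⟩ := finrank_eq_one_iff'.mp hr'
  obtain ⟨c, hc⟩ := hv ⟨P (B v), LinearMap.mem_range_self _ _⟩
  have hPv : P v = v := (LinearMap.IsIdempotentElem.mem_range_iff hP).mp v.2
  have hBv : B v = c • (v : V) := by
    have h1 : B (P v) = P (B v) := LinearMap.congr_fun hB.eq v
    rw [hPv] at h1
    rw [h1]
    exact (congrArg Subtype.val hc).symm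
  have hBP : B * P = c • P := by
    ext w
    obtain ⟨d, hd⟩ := hv ⟨P w, LinearMap.mem_range_self _ _⟩
    have hd' : P w = d • (v : V) := (congrArg Subtype.val hd).symm
    change B (P w) = c • P w
    rw [hd', map_smul, hBv, smul_comm]
  rw [mul_assoc, hBP, mul_smul_comm, map_smul, map_smul, hP1]
  simp [mul_comm]

end Fourier

section HalfDegree

open Multiplicative

variable {F : Type*} [Field F] [Fintype F] [DecidableEq F]

lemma eq_or_eq_of_square_invariant {K : Type*} {ν : F} (hν : ¬IsSquare ν)
    (f : F → K) (hf : ∀ (a : Fˣ) c, f ((a : F) ^ 2 * c) = f c) {x : F} (hx : x ≠ 0) :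
    (quadraticChar F x = 1 ∧ f x = f 1) ∨ (quadraticChar F x = -1 ∧ f x = f ν) := by
  have hν0 : ν ≠ 0 := by
    rintro rfl
    exact hν (IsSquare.zero)
  have hνc : quadraticChar F ν = -1 := quadraticChar_neg_one_iff_not_isSquare.mpr hν
  have key (y : F) (hy : y ≠ 0) (h : IsSquare y) (z : F) : f (y * z) = f z := by
    obtain ⟨r, rfl⟩ := h
    have hr : r ≠ 0 := by rintro rfl; simp at hy
    rw [← pow_two]
    exact hf (Units.mk0 r hr) z
  rcases quadraticChar_dichotomy hx with h | h
  · refine Or.inl ⟨h, ?_⟩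
    rw [← key x hx ((quadraticChar_one_iff_isSquare hx).mp h) 1, mul_one]
  · refine Or.inr ⟨h, ?_⟩
    have hy : x / ν ≠ 0 := div_ne_zero hx hν0
    rw [← key (x / ν) hy ?_ ν, div_mul_cancel₀ _ hν0]
    rw [← quadraticChar_one_iff_isSquare hy]
    have : quadraticChar F (x / ν) * quadraticChar F ν = quadraticChar F x := by
      rw [← map_mul, div_mul_cancel₀ _ hν0]
    rw [hνc, h] at this
    linarith

lemma sum_eq_zero_add {K : Type*} [AddCommMonoid K] (f : F → K) :
    ∑ x, f x = f 0 + ∑ x : F with x ≠ 0, f x := by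
  rw [Finset.filter_ne', Finset.add_sum_erase _ _ (Finset.mem_univ 0)]

lemma sum_square_invariant {K : Type*} [Field K] [CharZero K] (h2 : (2 : F) ≠ 0) {ν : F}
    (hν : ¬IsSquare ν) (f : F → K) (hf : ∀ (a : Fˣ) c, f ((a : F) ^ 2 * c) = f c) :
    ∑ x : F with x ≠ 0, f x = (Fintype.card F - 1) / 2 * (f 1 + f ν) := by
  have hchar : ringChar F ≠ 2 := fun h => h2 (by
    have := ringChar.Nat.cast_ringChar (R := F)
    rw [h] at this
    exact_mod_cast this)
  have h (x : F) (hx : x ∈ Finset.univ.filter (fun x : F => x ≠ 0)) :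
      f x = (f 1 + f ν) / 2 + (quadraticChar F x : K) * ((f 1 - f ν) / 2) := by
    rcases eq_or_eq_of_square_invariant hν f hf (Finset.mem_filter.mp hx).2 with h | h
    · rw [h.1, h.2]; push_cast; ring
    · rw [h.1, h.2]; push_cast; ring
  have hs : ∑ x : F with x ≠ 0, (quadraticChar F x : K) = 0 := by
    rw [Finset.sum_filter_of_ne (by rintro x - hx rfl; simp at hx)]
    exact_mod_cast congrArg (Int.cast (R := K)) (quadraticChar_sum_zero hchar)
  rw [Finset.sum_congr rfl h, Finset.sum_add_distrib, ← Finset.sum_mul, hs, Finset.sum_const,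
    nsmul_eq_mul, Finset.filter_ne', Finset.card_erase_of_mem (Finset.mem_univ _),
    Finset.card_univ, Nat.cast_sub Fintype.card_pos]
  push_cast
  ring

lemma card_sq_ne_one (h2 : (2 : F) ≠ 0) :
    (Finset.univ.filter fun a : Fˣ => a ^ 2 ≠ 1).card = Fintype.card F - 3 := by
  have h := Finset.card_filter_add_card_filter_not (s := (Finset.univ : Finset Fˣ))
    (fun a : Fˣ => a ^ 2 ≠ 1)
  rw [filter_sq_eq_one, Finset.card_pair (one_ne_neg_one_units h2), Finset.card_univ,
    Fintype.card_units] at h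
  omega

/-- The unipotent upper triangular subgroup, as a homomorphism from the additive group. -/
def unipotentHom : Multiplicative F →* SL(2, F) where
  toFun x := upperSL 1 x.toAdd
  map_one' := upperSL_one_zero
  map_mul' x y := by rw [upperSL_mul]; simp [add_comm]

variable {V : Type*} [AddCommGroup V] [Module ℂ V] [FiniteDimensional ℂ V]
  (ρ : Representation ℂ SL(2, F) V)

omit [Fintype F] [DecidableEq F] [FiniteDimensional ℂ V] in
lemma character_unipotent_sq_mul (a : Fˣ) (x : F) :
    ρ.character (upperSL 1 ((a : F) ^ 2 * x)) = ρ.character (upperSL 1 x) := by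
  rw [← upperSL_conj_unipotent, ρ.char_conj]

omit [Fintype F] [DecidableEq F] [FiniteDimensional ℂ V] in
lemma character_upperSL_of_sq_ne_one (a : Fˣ) (ha : a ^ 2 ≠ 1) (x : F) :
    ρ.character (upperSL a x) = ρ.character (upperSL a 0) := by
  obtain ⟨h, hh⟩ := exists_conj_upperSL a ha x
  rw [← hh, ρ.char_conj]

omit [DecidableEq F] in
lemma character_inv_eq_conj (g : SL(2, F)) :
    ρ.character g⁻¹ = (starRingEnd ℂ) (ρ.character g) :=
  trace_inv_eq_conj ρ g

lemma half_degree_unipotent_sums (hq : 9 ≤ Fintype.card F) (h2 : (2 : F) ≠ 0)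
    (hdeg : ρ.character 1 = (Fintype.card F + 1) / 2)
    (hnt : ∃ x, ρ.character (upperSL 1 x) ≠ ρ.character 1) :
    ∑ x : F, ρ.character (upperSL 1 x) = Fintype.card F ∧
    ∑ x : F, ρ.character (upperSL 1 x) * ρ.character (upperSL 1 (-x)) =
      Fintype.card F * (Fintype.card F + 1) / 2 := by
  obtain ⟨ν, hν⟩ : ∃ ν : F, ¬IsSquare ν := by
    refine FiniteField.exists_nonsquare fun h => h2 ?_
    have := ringChar.Nat.cast_ringChar (R := F)
    rw [h] at this
    exact_mod_cast this
  obtain ⟨ψ, hψ1⟩ := AddChar.exists_apply_ne_zero.mpr (one_ne_zero (α := F))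
  have hψ : ψ.IsPrimitive := AddChar.IsPrimitive.of_ne_one (by rintro rfl; simp at hψ1)
  obtain ⟨m, hm, hχ⟩ := exists_multiplicities hψ (ρ.comp unipotentHom)
  replace hχ : ∀ b, ρ.character (upperSL 1 b) = ∑ c, m c * ψ (c * b) := hχ
  have hq0 : (Fintype.card F : ℂ) ≠ 0 := by simp
  replace hm (c : F) : ∑ b : F, ψ (-(c * b)) * ρ.character (upperSL 1 b) =
      Fintype.card F * m c := by
    have := hm c
    rw [trace_isotypicProj, inv_mul_eq_iff_eq_mul₀ hq0] at this
    exact this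
  have hinv (a : Fˣ) (c : F) : m ((a : F) ^ 2 * c) = m c := by
    have h : (Fintype.card F : ℂ) * m ((a : F) ^ 2 * c) = Fintype.card F * m c := by
      rw [← hm, ← hm, ← Equiv.sum_comp (Units.mulLeft (a ^ 2))
        (fun b => ψ (-(c * b)) * ρ.character (upperSL 1 b))]
      refine Finset.sum_congr rfl fun b _ => ?_
      rw [Units.mulLeft_apply, Units.val_pow_eq_pow_val, character_unipotent_sq_mul]
      congr 2
      ring
    exact_mod_cast mul_left_cancel₀ hq0 h
  have hsum : ρ.character 1 = ∑ c, (m c : ℂ) := by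
    have := hχ 0
    simpa [upperSL_one_zero] using this
  have hsplit := sum_eq_zero_add fun c => (m c : ℂ)
  have hclass := sum_square_invariant h2 hν (fun c => (m c : ℂ))
    (fun a c => by rw [hinv])
  have hnat : 2 * m 0 + (Fintype.card F - 1) * (m 1 + m ν) = Fintype.card F + 1 := by
    have : (2 * m 0 + (Fintype.card F - 1) * (m 1 + m ν) : ℂ) = Fintype.card F + 1 := by
      rw [hsplit, hclass, hdeg] at hsum
      linear_combination -2 * hsum
    have hc : ((Fintype.card F - 1 : ℕ) : ℂ) = (Fintype.card F : ℂ) - 1 := by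
      rw [Nat.cast_sub Fintype.card_pos, Nat.cast_one]
    rw [← hc] at this
    exact_mod_cast this
  have hone : m 1 + m ν = 1 ∧ m 0 = 1 := by
    have h0 : m 1 + m ν ≠ 0 := by
      intro h
      obtain ⟨x, hx⟩ := hnt
      have hz (c : F) (hc : c ≠ 0) : m c = 0 := by
        rcases eq_or_eq_of_square_invariant hν m hinv hc with h' | h' <;> omega
      apply hx
      rw [hsum, hχ]
      refine Finset.sum_congr rfl fun c _ => ?_
      by_cases hc : c = 0
      · simp [hc]
      · simp [hz c hc]
    have h1 : m 1 + m ν < 2 := by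
      by_contra! h
      have := Nat.mul_le_mul_left (Fintype.card F - 1) h
      omega
    have h3 : m 1 + m ν = 1 := by omega
    rw [h3] at hnat
    omega
  have hidem (c : F) : (m c : ℂ) * m c = m c := by
    have : m c = 0 ∨ m c = 1 := by
      by_cases hc : c = 0
      · rw [hc]; omega
      · rcases eq_or_eq_of_square_invariant hν m hinv hc with h' | h' <;> omega
    rcases this with h | h <;> simp [h]
  constructor
  · have := hm 0
    simpa [hone.2] using this
  · have h (c : F) : ∑ x : F, m c * ψ (c * x) * ρ.character (upperSL 1 (-x)) =
        Fintype.card F * m c := by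
      simp_rw [mul_assoc]
      rw [← Finset.mul_sum, ← Equiv.sum_comp (Equiv.neg F)]
      simp only [Equiv.neg_apply, mul_neg, neg_neg]
      rw [hm, mul_left_comm, hidem]
    have h' (x : F) : ρ.character (upperSL 1 x) * ρ.character (upperSL 1 (-x)) =
        ∑ c, m c * ψ (c * x) * ρ.character (upperSL 1 (-x)) := by
      rw [hχ x, Finset.sum_mul]
    rw [Finset.sum_congr rfl fun x _ => h' x, Finset.sum_comm, Finset.sum_congr rfl fun c _ => h c,
      ← Finset.mul_sum, ← hsum, hdeg]
    ring

omit [DecidableEq F] in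
lemma character_torus_sq (hU : ∑ x : F, ρ.character (upperSL 1 x) = Fintype.card F)
    (a : Fˣ) (ha : a ^ 2 ≠ 1) : ρ.character (upperSL a 0) ^ 2 = 1 := by
  have hq0 : (Fintype.card F : ℂ) ≠ 0 := by simp
  set P := isotypicProj 1 (ρ.comp unipotentHom) (0 : F) with hPdef
  have hPeq : P = (Fintype.card F : ℂ)⁻¹ • ∑ b : F, ρ (upperSL 1 b) := by
    simp [hPdef, isotypicProj, unipotentHom]
  have hP : IsIdempotentElem P := isIdempotentElem_isotypicProj _ _ _
  have hP1 : LinearMap.trace ℂ V P = 1 := by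
    rw [hPeq, map_smul, map_sum]
    change (Fintype.card F : ℂ)⁻¹ * ∑ b : F, ρ.character (upperSL 1 b) = 1
    rw [hU, inv_mul_cancel₀ hq0]
  have hcomm (b : Fˣ) : Commute (ρ (upperSL b 0)) P := by
    rw [commute_iff_eq, hPeq, mul_smul_comm, smul_mul_assoc, Finset.mul_sum, Finset.sum_mul]
    congr 1
    rw [← Equiv.sum_comp (Units.mulLeft (b ^ 2)) (fun x => ρ (upperSL 1 x) * ρ (upperSL b 0))]
    refine Finset.sum_congr rfl fun x _ => ?_
    rw [Units.mulLeft_apply, Units.val_pow_eq_pow_val, ← upperSL_conj_unipotent, ← map_mul,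
      ← map_mul, inv_mul_cancel_right]
  have htr (b : Fˣ) (hb : b ^ 2 ≠ 1) :
      LinearMap.trace ℂ V (ρ (upperSL b 0) * P) = ρ.character (upperSL b 0) := by
    rw [hPeq, mul_smul_comm, Finset.mul_sum, map_smul, map_sum]
    have (x : F) : LinearMap.trace ℂ V (ρ (upperSL b 0) * ρ (upperSL 1 x)) =
        ρ.character (upperSL b 0) := by
      rw [← map_mul, upperSL_mul, mul_one]
      exact character_upperSL_of_sq_ne_one ρ b hb _
    simp [this, hq0]
  have hinv : a⁻¹ ^ 2 ≠ 1 := by simpa using ha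
  have h := trace_mul_trace_of_trace_eq_one (A := ρ (upperSL a 0)) hP hP1 (hcomm a⁻¹)
  rw [htr a ha, htr a⁻¹ hinv, ← map_mul, upperSL_mul, ← weylSL_conj a, ρ.char_conj] at h
  simpa [upperSL_one_zero, hP1, pow_two] using h

end HalfDegree

section Values

variable {F : Type*} [Field F] [Fintype F] [DecidableEq F]

/-- The properties of a class function on `SL₂(F)` shared by the lifts of the irreducible
characters of degree `(|F| + 1) / 2` of `PSL₂(F)`, for a nonsquare `ν`. -/
structure IsHalfDegree (ν : F) (χ : SL(2, F) → ℂ) : Prop where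
  conj : ∀ h g, χ (h * g * h⁻¹) = χ g
  neg : ∀ g, χ (-g) = χ g
  real : ∀ g, (starRingEnd ℂ) (χ g) = χ g
  one : χ 1 = (Fintype.card F + 1) / 2
  vanish : ∀ g, borelCount g = 0 → χ g = 0
  torus : ∀ a : Fˣ, a ^ 2 ≠ 1 → χ (upperSL a 0) = 1 ∨ χ (upperSL a 0) = -1
  torus_sum : ∑ a : Fˣ with a ^ 2 ≠ 1, χ (upperSL a 0) = -2
  unipotent_add : χ (upperSL 1 1) + χ (upperSL 1 ν) = 1
  unipotent_sq : χ (upperSL 1 1) ^ 2 + χ (upperSL 1 ν) ^ 2 = (Fintype.card F + 1) / 2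

lemma card_SL_two_cast {K : Type*} [Field K] [CharZero K] :
    (Fintype.card SL(2, F) : K) =
      (Fintype.card F + 1) * ((Fintype.card F - 1) * Fintype.card F) := by
  rw [card_SL_two]
  push_cast [Nat.cast_sub (Fintype.card_pos (α := F))]
  ring

lemma card_ne_zero_cast {K : Type*} [Field K] [CharZero K] :
    ((Finset.univ.filter fun x : F => x ≠ 0).card : K) = Fintype.card F - 1 := by
  rw [Finset.filter_ne', Finset.card_erase_of_mem (Finset.mem_univ _), Finset.card_univ,
    Nat.cast_sub Fintype.card_pos, Nat.cast_one]

lemma card_sq_ne_one_cast {K : Type*} [Field K] [CharZero K] (hq : 3 ≤ Fintype.card F)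
    (h2 : (2 : F) ≠ 0) :
    ((Finset.univ.filter fun a : Fˣ => a ^ 2 ≠ 1).card : K) = Fintype.card F - 3 := by
  rw [card_sq_ne_one h2, Nat.cast_sub hq]
  norm_num

variable {V : Type*} [AddCommGroup V] [Module ℂ V] [FiniteDimensional ℂ V]
  {ρ : Representation ℂ SL(2, F) V}

omit [DecidableEq F] in
lemma character_mul_inv_eq_normSq (g : SL(2, F)) :
    ρ.character g * ρ.character g⁻¹ = (Complex.normSq (ρ.character g) : ℂ) := by
  rw [character_inv_eq_conj, Complex.mul_conj]

lemma sum_normSq_eq_card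
    (hirr : ∑ g, ρ.character g * ρ.character g⁻¹ = Fintype.card SL(2, F)) :
    ∑ g, Complex.normSq (ρ.character g) = Fintype.card SL(2, F) := by
  simp_rw [character_mul_inv_eq_normSq] at hirr
  exact_mod_cast hirr

omit [FiniteDimensional ℂ V] in
lemma sum_split_normSq (h2 : (2 : F) ≠ 0) (hneg : ∀ g, ρ.character (-g) = ρ.character g) :
    ∑ g, (if borelCount g = 0 then 0 else Complex.normSq (ρ.character g)) =
      2 * Complex.normSq (ρ.character 1) + 2 * (Fintype.card F + 1) *
        ∑ x : F with x ≠ 0, Complex.normSq (ρ.character (upperSL 1 x)) +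
      Fintype.card F * (Fintype.card F + 1) / 2 *
        ∑ a : Fˣ with a ^ 2 ≠ 1, Complex.normSq (ρ.character (upperSL a 0)) :=
  sum_split_classFunction h2 _ (fun h g => by rw [ρ.char_conj]) (fun g => by rw [hneg])

lemma exists_unipotent_character_ne (hq : 9 ≤ Fintype.card F) (h2 : (2 : F) ≠ 0)
    (hneg : ∀ g, ρ.character (-g) = ρ.character g)
    (hirr : ∑ g, ρ.character g * ρ.character g⁻¹ = Fintype.card SL(2, F))
    (hdeg : ρ.character 1 = (Fintype.card F + 1) / 2) :
    ∃ x, ρ.character (upperSL 1 x) ≠ ρ.character 1 := by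
  by_contra! h
  have hle : ∑ g, (if borelCount g = 0 then 0 else Complex.normSq (ρ.character g)) ≤
      ∑ g, Complex.normSq (ρ.character g) := by
    refine Finset.sum_le_sum fun g _ => ?_
    split_ifs
    · exact Complex.normSq_nonneg _
    · exact le_rfl
  rw [sum_split_normSq h2 hneg, sum_normSq_eq_card hirr, card_SL_two_cast] at hle
  have hd : Complex.normSq (ρ.character 1) = ((Fintype.card F + 1) / 2) ^ 2 := by
    rw [hdeg, show ((Fintype.card F : ℂ) + 1) / 2 = (((Fintype.card F : ℝ) + 1) / 2 : ℝ) by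
      push_cast; ring, Complex.normSq_ofReal, pow_two]
  simp_rw [h, hd, Finset.sum_const, nsmul_eq_mul, card_ne_zero_cast] at hle
  have h0 : 0 ≤ ∑ a : Fˣ with a ^ 2 ≠ 1, Complex.normSq (ρ.character (upperSL a 0)) :=
    Finset.sum_nonneg fun _ _ => Complex.normSq_nonneg _
  have hq' : (9 : ℝ) ≤ Fintype.card F := by exact_mod_cast hq
  generalize (∑ a : Fˣ with a ^ 2 ≠ 1, Complex.normSq (ρ.character (upperSL a 0))) = S at *
  generalize (Fintype.card F : ℝ) = q at *
  have h1 : 0 ≤ q * (q + 1) / 2 * S := by positivity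
  have h3 : 0 < q * (q + 1) * (q * (q + 1) - 2 * (q - 1)) := by
    refine mul_pos (by positivity) ?_
    nlinarith
  nlinarith

theorem isHalfDegree_character (hq : 9 ≤ Fintype.card F) (hsq : IsSquare (-1 : F))
    (h2 : (2 : F) ≠ 0) {ν : F} (hν : ¬IsSquare ν)
    (hneg : ∀ g, ρ.character (-g) = ρ.character g)
    (hirr : ∑ g, ρ.character g * ρ.character g⁻¹ = Fintype.card SL(2, F))
    (hdeg : ρ.character 1 = (Fintype.card F + 1) / 2) : IsHalfDegree ν ρ.character := by
  have hq0 : (Fintype.card F : ℂ) ≠ 0 := by simp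
  have hq1 : (Fintype.card F : ℂ) - 1 ≠ 0 := by
    rw [sub_ne_zero]; norm_cast; omega
  have hq2 : (Fintype.card F : ℂ) + 1 ≠ 0 := by
    exact_mod_cast Nat.succ_ne_zero (Fintype.card F)
  obtain ⟨hU, hUU⟩ := half_degree_unipotent_sums ρ hq h2 hdeg
    (exists_unipotent_character_ne hq h2 hneg hirr hdeg)
  have hUneg (x : F) : ρ.character (upperSL 1 (-x)) = ρ.character (upperSL 1 x) := by
    obtain ⟨i, hi⟩ := hsq
    have hi0 : i ≠ 0 := by rintro rfl; simp at hi
    have := character_unipotent_sq_mul ρ (Units.mk0 i hi0) x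
    rwa [Units.val_mk0, pow_two, ← hi, neg_one_mul] at this
  have hUreal (x : F) :
      (starRingEnd ℂ) (ρ.character (upperSL 1 x)) = ρ.character (upperSL 1 x) := by
    rw [← character_inv_eq_conj, upperSL_inv, inv_one, hUneg]
  have htorus (a : Fˣ) (ha : a ^ 2 ≠ 1) :
      ρ.character (upperSL a 0) = 1 ∨ ρ.character (upperSL a 0) = -1 :=
    sq_eq_one_iff.mp (character_torus_sq ρ hU a ha)
  have hUne : ∑ x : F with x ≠ 0, ρ.character (upperSL 1 x) = (Fintype.card F - 1) / 2 := by
    rw [sum_eq_zero_add, upperSL_one_zero, hdeg] at hU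
    linear_combination hU
  have hUUne : ∑ x : F with x ≠ 0, ρ.character (upperSL 1 x) ^ 2 =
      (Fintype.card F + 1) * (Fintype.card F - 1) / 4 := by
    simp_rw [hUneg, ← pow_two] at hUU
    rw [sum_eq_zero_add, upperSL_one_zero, hdeg] at hUU
    linear_combination hUU
  have hvanish : ∀ g, borelCount g = 0 → ρ.character g = 0 := by
    have hUnorm : ∑ x : F with x ≠ 0, Complex.normSq (ρ.character (upperSL 1 x)) =
        ((Fintype.card F : ℝ) + 1) * (Fintype.card F - 1) / 4 := by
      have (x : F) : ρ.character (upperSL 1 x) ^ 2 =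
          (Complex.normSq (ρ.character (upperSL 1 x)) : ℂ) := by
        rw [← Complex.mul_conj, hUreal, pow_two]
      simp_rw [this] at hUUne
      exact_mod_cast hUUne
    have hTnorm : ∑ a : Fˣ with a ^ 2 ≠ 1, Complex.normSq (ρ.character (upperSL a 0)) =
        (Fintype.card F : ℝ) - 3 := by
      rw [Finset.sum_congr rfl (g := fun _ => 1), Finset.sum_const, nsmul_eq_mul, mul_one,
        card_sq_ne_one_cast (by omega) h2]
      intro a ha
      rcases htorus a (Finset.mem_filter.mp ha).2 with h | h <;> simp [h]
    have hd : Complex.normSq (ρ.character 1) = ((Fintype.card F + 1) / 2) ^ 2 := by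
      rw [hdeg, show ((Fintype.card F : ℂ) + 1) / 2 = (((Fintype.card F : ℝ) + 1) / 2 : ℝ) by
        push_cast; ring, Complex.normSq_ofReal, pow_two]
    have hsum : ∑ g, (Complex.normSq (ρ.character g) -
        if borelCount g = 0 then 0 else Complex.normSq (ρ.character g)) = 0 := by
      rw [Finset.sum_sub_distrib, sum_split_normSq h2 hneg, sum_normSq_eq_card hirr,
        card_SL_two_cast, hUnorm, hTnorm, hd]
      ring
    intro g hg
    have := (Finset.sum_eq_zero_iff_of_nonneg fun g _ => by
      split_ifs
      · simpa using Complex.normSq_nonneg _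
      · simp).mp hsum g (Finset.mem_univ g)
    simpa [hg] using this
  refine ⟨fun h g => ρ.char_conj g h, hneg, fun g => ?_, hdeg, hvanish, htorus, ?_, ?_, ?_⟩
  · by_cases hg : borelCount g = 0
    · simp [hvanish g hg]
    · obtain ⟨h, a, x, rfl⟩ := (borelCount_ne_zero_iff g).mp hg
      rw [ρ.char_conj]
      by_cases ha : a ^ 2 = 1
      · have ha' : a = 1 ∨ a = -1 := by
          have : a ∈ Finset.univ.filter fun a : Fˣ => ¬ a ^ 2 ≠ 1 := by simpa using ha
          rw [filter_sq_eq_one] at this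
          simpa using this
        rcases ha' with rfl | rfl
        · exact hUreal x
        · rw [upperSL_neg, hneg, hUreal]
      · rw [character_upperSL_of_sq_ne_one ρ a ha]
        rcases htorus a ha with h | h <;> simp [h]
  · have hinvariants := ρ.card_inv_mul_sum_char_eq_finrank
    rw [Nat.card_eq_fintype_card, inv_mul_eq_iff_eq_mul₀ (by simp)] at hinvariants
    generalize Module.finrank ℂ ρ.invariants = n at hinvariants
    have hsplit := sum_split_classFunction h2 ρ.character (fun h g => ρ.char_conj g h) hneg
    rw [Finset.sum_congr rfl (g := ρ.character) (fun g _ => by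
      split_ifs with h
      · exact (hvanish g h).symm
      · rfl), hinvariants, card_SL_two_cast, hUne, hdeg] at hsplit
    set σ := ∑ a : Fˣ with a ^ 2 ≠ 1, ρ.character (upperSL a 0) with hσ
    have hσn : σ = 2 * n * (Fintype.card F - 1) - 2 := by
      have : (Fintype.card F : ℂ) * (Fintype.card F + 1) *
          (σ - (2 * n * (Fintype.card F - 1) - 2)) = 0 := by
        linear_combination -2 * hsplit
      rw [mul_eq_zero, sub_eq_zero] at this
      exact this.resolve_left (mul_ne_zero hq0 hq2)
    have hle : σ.re ≤ Fintype.card F - 3 := by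
      rw [hσ, Complex.re_sum, ← card_sq_ne_one_cast (by omega) h2, ← nsmul_one]
      refine Finset.sum_le_card_nsmul _ _ _ fun a ha => ?_
      rcases htorus a (Finset.mem_filter.mp ha).2 with h | h <;> simp [h]
    rw [show σ = ((2 * n * ((Fintype.card F : ℝ) - 1) - 2 : ℝ) : ℂ) by rw [hσn]; push_cast; ring,
      Complex.ofReal_re] at hle
    have hn : n = 0 := by
      by_contra hn
      have hn' : (1 : ℝ) ≤ n := by exact_mod_cast Nat.one_le_iff_ne_zero.mpr hn
      have hq' : (9 : ℝ) ≤ Fintype.card F := by exact_mod_cast hq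
      nlinarith
    rw [hσn, hn]
    simp
  · have := sum_square_invariant h2 hν (fun x => ρ.character (upperSL 1 x))
      (character_unipotent_sq_mul ρ)
    rw [hUne] at this
    apply mul_left_cancel₀ hq1
    linear_combination -2 * this
  · have := sum_square_invariant h2 hν (fun x => ρ.character (upperSL 1 x) ^ 2)
      (fun a x => by rw [character_unipotent_sq_mul])
    rw [hUUne] at this
    apply mul_left_cancel₀ hq1
    linear_combination -2 * this

lemma IsHalfDegree.sum_mul_of_conj_neg {ν : F} {χ : SL(2, F) → ℂ} (hχ : IsHalfDegree ν χ)
    (h2 : (2 : F) ≠ 0) (hν : ¬IsSquare ν) (f : SL(2, F) → ℂ)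
    (hf : ∀ h g, f (h * g * h⁻¹) = f g) (hneg : ∀ g, f (-g) = f g) :
    ∑ g, χ g * f g = (Fintype.card F + 1) * f 1 +
      (Fintype.card F + 1) * (Fintype.card F - 1) *
        (χ (upperSL 1 1) * f (upperSL 1 1) + χ (upperSL 1 ν) * f (upperSL 1 ν)) +
      Fintype.card F * (Fintype.card F + 1) / 2 *
        ∑ a : Fˣ with a ^ 2 ≠ 1, χ (upperSL a 0) * f (upperSL a 0) := by
  have h := sum_split_classFunction h2 (fun g => χ g * f g)
    (fun h g => by rw [hχ.conj, hf]) (fun g => by rw [hχ.neg, hneg])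
  rw [Finset.sum_congr rfl (g := fun g => χ g * f g) (fun g _ => by
    split_ifs with h
    · rw [hχ.vanish g h, zero_mul]
    · rfl), sum_square_invariant h2 hν (fun x => χ (upperSL 1 x) * f (upperSL 1 x))
      (fun a x => by rw [← upperSL_conj_unipotent, hχ.conj, hf]), hχ.one] at h
  rw [h]
  ring

theorem IsHalfDegree.sum_sq_mul_eq_zero (hq : 9 ≤ Fintype.card F) (h2 : (2 : F) ≠ 0) {ν : F}
    (hν : ¬IsSquare ν) {χ χ' : SL(2, F) → ℂ} (hχ : IsHalfDegree ν χ) (hχ' : IsHalfDegree ν χ')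
    (horth : ∑ g, χ g * χ' g = 0) : ∑ g, χ g ^ 2 * χ' g = 0 := by
  have hq2 : (Fintype.card F : ℂ) + 1 ≠ 0 := by
    exact_mod_cast Nat.succ_ne_zero (Fintype.card F)
  have hadd := hχ.unipotent_add
  have hadd' := hχ'.unipotent_add
  have hsq := hχ.unipotent_sq
  have hsq' := hχ'.unipotent_sq
  simp_rw [pow_two, mul_assoc]
  rw [hχ.sum_mul_of_conj_neg h2 hν (fun g => χ g * χ' g)
    (fun h g => by rw [hχ.conj, hχ'.conj]) (fun g => by rw [hχ.neg, hχ'.neg])]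
  rw [hχ.sum_mul_of_conj_neg h2 hν χ' hχ'.conj hχ'.neg, hχ'.one] at horth
  have hT : ∑ a : Fˣ with a ^ 2 ≠ 1,
      χ (upperSL a 0) * (χ (upperSL a 0) * χ' (upperSL a 0)) = -2 := by
    rw [← hχ'.torus_sum]
    refine Finset.sum_congr rfl fun a ha => ?_
    rcases hχ.torus a (Finset.mem_filter.mp ha).2 with h | h <;> simp [h]
  rw [hT, hχ.one, hχ'.one]
  generalize χ (upperSL 1 1) = x at *
  generalize χ (upperSL 1 ν) = y at *
  generalize χ' (upperSL 1 1) = x' at *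
  generalize χ' (upperSL 1 ν) = y' at *
  obtain rfl : y = 1 - x := by linear_combination hadd
  obtain rfl : y' = 1 - x' := by linear_combination hadd'
  have hcases : (x - x') * (x - (1 - x')) = 0 := by
    linear_combination (hsq - hsq') / 2
  rw [mul_eq_zero, sub_eq_zero, sub_eq_zero] at hcases
  rcases hcases with rfl | rfl
  · exfalso
    set S := ∑ a : Fˣ with a ^ 2 ≠ 1, χ (upperSL a 0) * χ' (upperSL a 0) with hS
    have hle : -((Fintype.card F : ℝ) - 3) ≤ S.re := by
      rw [hS, Complex.re_sum, ← card_sq_ne_one_cast (by omega) h2, ← mul_neg_one,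
        ← nsmul_eq_mul]
      refine Finset.card_nsmul_le_sum _ _ _ fun a ha => ?_
      rcases hχ.torus a (Finset.mem_filter.mp ha).2 with h | h <;>
        rcases hχ'.torus a (Finset.mem_filter.mp ha).2 with h' | h' <;> simp [h, h']
    have hSeq : (Fintype.card F : ℂ) * (Fintype.card F + 1 + S) = 0 := by
      apply mul_left_cancel₀ hq2
      linear_combination 2 * horth - 2 * (Fintype.card F + 1) * (Fintype.card F - 1) * hsq
    rw [mul_eq_zero, or_iff_right (by simp)] at hSeq
    have := congrArg Complex.re hSeq
    simp at this
    linarith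
  · linear_combination
      (1 - (Fintype.card F : ℂ)) * (Fintype.card F + 1) / 2 * hsq

end Values

section Quotient

lemma exists_sum_comp_eq {G H : Type*} [Group G] [Group H] [Fintype G] [Fintype H] (π : G →* H)
    (hπ : Function.Surjective π) :
    ∃ N : ℕ, N ≠ 0 ∧ Fintype.card G = N * Fintype.card H ∧
      ∀ f : H → ℂ, ∑ g, f (π g) = N * ∑ h, f h := by
  classical
  have hfib (h : H) : (Finset.univ.filter fun g => π g = h).card =
      (Finset.univ.filter fun g => π g = 1).card :=
    MonoidHom.card_fiber_eq_of_mem_range π (hπ h) (hπ 1)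
  refine ⟨(Finset.univ.filter fun g => π g = 1).card, ?_, ?_, fun f => ?_⟩
  · exact Finset.card_ne_zero.mpr ⟨1, by simp⟩
  · rw [← Finset.card_univ, Finset.card_eq_sum_card_fiberwise (f := π) (t := Finset.univ)
      (fun _ _ => Finset.mem_coe.mpr (Finset.mem_univ _)),
      Finset.sum_congr rfl fun h _ => hfib h]
    simp [mul_comm]
  · rw [← Finset.sum_fiberwise (s := Finset.univ) (g := π), Finset.mul_sum]
    refine Finset.sum_congr rfl fun h _ => ?_
    rw [Finset.sum_congr rfl (g := fun _ => f h) fun g hg => by rw [(Finset.mem_filter.mp hg).2],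
      Finset.sum_const, hfib, nsmul_eq_mul]

lemma sum_character_mul_inv {G : Type} [Group G] [Fintype G] (V W : FDRep ℂ G)
    [CategoryTheory.Simple V] [CategoryTheory.Simple W] :
    (∑ g, V.character g * V.character g⁻¹ = Fintype.card G) ∧
      (V.character ≠ W.character → ∑ g, V.character g * W.character g⁻¹ = 0) := by
  have hc : (Nat.card G : ℂ) ≠ 0 := by simp
  let := invertibleOfNonzero hc
  constructor
  · have := FDRep.char_orthonormal V V
    rw [if_pos ⟨CategoryTheory.Iso.refl V⟩, inv_mul_eq_iff_eq_mul₀ hc, mul_one] at this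
    rw [this, Nat.card_eq_fintype_card]
  · intro hne
    have := FDRep.char_orthonormal V W
    rw [if_neg (fun ⟨i⟩ => hne (FDRep.char_iso i)), inv_mul_eq_iff_eq_mul₀ hc, mul_zero] at this
    exact this

variable {F : Type} [Field F]

/-- The character of `SL₂` obtained by inflating a representation of `PSL₂`. -/
noncomputable def inflation (V : FDRep ℂ PSL(2, F)) : Representation ℂ SL(2, F) V :=
  V.ρ.comp (QuotientGroup.mk' (Subgroup.center SL(2, F)))

lemma inflation_character (V : FDRep ℂ PSL(2, F)) (g : SL(2, F)) :
    (inflation V).character g = V.character (QuotientGroup.mk' (Subgroup.center SL(2, F)) g) :=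
  rfl

lemma inflation_character_neg (V : FDRep ℂ PSL(2, F)) (g : SL(2, F)) :
    (inflation V).character (-g) = (inflation V).character g := by
  rw [inflation_character, inflation_character]
  congr 1
  rw [QuotientGroup.mk'_eq_mk']
  refine ⟨-1, ?_, by simp⟩
  rw [Subgroup.mem_center_iff]
  intro h
  simp

end Quotient

/-- For a prime power `q ≥ 9` with `q ≡ 1 (mod 4)` and `G = PSL₂(q)`, if `χ ≠ χ'` are two
distinct irreducible characters of degree `(q + 1)/2`, then `⟨χ², χ'⟩ = 0`; in particular
`c(χ²) ≠ Irr(G)`, so the character covering number of `G` is not `2`. -/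
theorem psl2_one_mod_four_half_degree_square_misses
    (q : ℕ) (hq9 : 9 ≤ q) (hq : ∃ p n : ℕ, p.Prime ∧ 0 < n ∧ q = p ^ n) (hq4 : q % 4 = 1)
    (F : Type) [Field F] [Fintype F] (hF : Fintype.card F = q)
    (χ χ' : Matrix.ProjectiveSpecialLinearGroup (Fin 2) F → ℂ)
    (hχ : IsIrreducibleCharacter _ χ) (hχ' : IsIrreducibleCharacter _ χ')
    (hne : χ ≠ χ')
    (hχdeg : χ 1 = ((q : ℂ) + 1) / 2) (hχ'deg : χ' 1 = ((q : ℂ) + 1) / 2) :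
    charInner (fun g => χ g ^ 2) χ' = 0 := by
  classical
  obtain ⟨V, hV, rfl⟩ := hχ
  obtain ⟨W, hW, rfl⟩ := hχ'
  have hq' : 9 ≤ Fintype.card F := hF ▸ hq9
  have hsq : IsSquare (-1 : F) := by
    rw [FiniteField.isSquare_neg_one_iff, hF]
    omega
  have hchar : ringChar F ≠ 2 := fun h => by
    have := FiniteField.even_card_of_char_two h
    omega
  have h2 : (2 : F) ≠ 0 := Ring.two_ne_zero hchar
  obtain ⟨ν, hν⟩ := FiniteField.exists_nonsquare hchar
  let : Fintype PSL(2, F) := Fintype.ofFinite _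
  obtain ⟨N, hN, hcard, hsum⟩ := exists_sum_comp_eq
    (QuotientGroup.mk' (Subgroup.center SL(2, F))) (QuotientGroup.mk'_surjective _)
  have half (U : FDRep ℂ PSL(2, F)) [CategoryTheory.Simple U]
      (hdeg : U.character 1 = ((q : ℂ) + 1) / 2) : IsHalfDegree ν (inflation U).character := by
    refine isHalfDegree_character hq' hsq h2 hν (inflation_character_neg U) ?_ ?_
    · simp_rw [inflation_character, map_inv]
      rw [hsum fun g => U.character g * U.character g⁻¹, (sum_character_mul_inv U U).1, hcard]
      push_cast
      rfl
    · rw [inflation_character, map_one, hdeg, hF]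
  have hV' := half V hχdeg
  have hW' := half W hχ'deg
  have horth : ∑ g, (inflation V).character g * (inflation W).character g = 0 := by
    have h := hsum fun g => V.character g * W.character g⁻¹
    rw [(sum_character_mul_inv V W).2 hne, mul_zero] at h
    rw [← h]
    refine Finset.sum_congr rfl fun g _ => ?_
    rw [← hW'.real g, ← character_inv_eq_conj, inflation_character, inflation_character, map_inv]
  have hzero := hV'.sum_sq_mul_eq_zero hq' h2 hν hW' horth
  have h := hsum fun g => V.character g ^ 2 * (starRingEnd ℂ) (W.character g)
  simp_rw [← inflation_character, hW'.real] at h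
  rw [hzero, zero_eq_mul, or_iff_right (Nat.cast_ne_zero.mpr hN)] at h
  rw [charInner, h, mul_zero]
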